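/- Let k be an algebraically closed field of characteristic 0 and F = k(x₁,…,xₙ) a rational function field over k. The assignment {f,g} ↦ dlog f ∧ dlog g determines a well-defined group homomorphism dlog : K₂ᴹ(F) → Ω²_{F/k}; it vanishes on all symbols {f,c} with f ∈ F*, c ∈ k*, hence descends to K₂(F)/Const; and the induced homomorphism K₂(F)/Const → Ω²_{F/k} is injective. -/

import Mathlib

open scoped TensorProduct

/-- Pre-K₂: the tensor square (over ℤ) of the unit group `F*`, written additively. -/
abbrev K2Pre (F : Type) [Field F] : Type :=
  (Additive Fˣ) ⊗[ℤ] (Additive Fˣ)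

/-- The subgroup of Steinberg relations, generated by the elements `f ⊗ (1 - f)`
for `f ∈ F*`, `f ≠ 1`. -/
noncomputable def steinberg (F : Type) [Field F] : Submodule ℤ (K2Pre F) :=
  Submodule.span ℤ {t | ∃ (f : Fˣ) (h : (1 : F) - (f : F) ≠ 0),
    t = Additive.ofMul f ⊗ₜ[ℤ] Additive.ofMul (Units.mk0 ((1 : F) - (f : F)) h)}

/-- The second Milnor K-group `K₂ᴹ(F)`. -/
noncomputable abbrev MilnorK2 (F : Type) [Field F] : Type :=
  K2Pre F ⧸ steinberg F

/-- The symbol `{f, g} ∈ K₂ᴹ(F)`. -/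
noncomputable def MilnorK2.symbol {F : Type} [Field F] (f g : Fˣ) : MilnorK2 F :=
  Submodule.Quotient.mk (Additive.ofMul f ⊗ₜ[ℤ] Additive.ofMul g)

/-- The subgroup of `K₂ᴹ(F)` generated by the symbols `{f, c}` with `f ∈ F*`, `c ∈ k*`. -/
noncomputable def constSymbols (k F : Type) [Field k] [Field F] [Algebra k F] :
    AddSubgroup (MilnorK2 F) :=
  AddSubgroup.closure {ξ | ∃ (f : Fˣ) (c : kˣ),
    ξ = MilnorK2.symbol f (Units.map (algebraMap k F).toMonoidHom c)}

/-- `K₂(F)/Const`. -/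
noncomputable abbrev K2ModConst (k F : Type) [Field k] [Field F] [Algebra k F] : Type :=
  MilnorK2 F ⧸ constSymbols k F

/-- The class of the symbol `{f, g}` in `K₂(F)/Const`, as a total function on `F`
(junk value `0` if `f` or `g` vanishes). -/
noncomputable def K2ModConst.symb (k : Type) {F : Type} [Field k] [Field F] [Algebra k F]
    (f g : F) : K2ModConst k F :=
  letI := Classical.propDecidable (f ≠ 0 ∧ g ≠ 0)
  if h : f ≠ 0 ∧ g ≠ 0 then
    QuotientAddGroup.mk (MilnorK2.symbol (Units.mk0 f h.1) (Units.mk0 g h.2))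
  else 0

/-- `dlog f = f⁻¹ · d f ∈ Ω_{F/k}`. -/
noncomputable def dlog (k : Type) {F : Type} [Field k] [Field F] [Algebra k F] (f : F) :
    Ω[F⁄k] :=
  f⁻¹ • (KaehlerDifferential.D k F) f

/-- The wedge `dlog f ∧ dlog g ∈ Ω²_{F/k}`, realized as a degree-two element of the
exterior algebra `Λ_F Ω_{F/k}` (in which `Ω²_{F/k} = Λ²_F Ω_{F/k}` embeds). -/
noncomputable def dlogWedge (k : Type) {F : Type} [Field k] [Field F] [Algebra k F] (f g : F) :
    ExteriorAlgebra F (Ω[F⁄k]) :=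
  ExteriorAlgebra.ι F (dlog k f) * ExteriorAlgebra.ι F (dlog k g)

namespace K2ModConst

section Symbols

variable {k F : Type} [Field k] [Field F] [Algebra k F]

theorem symb_units (f g : Fˣ) :
    symb k (f : F) (g : F) = QuotientAddGroup.mk (MilnorK2.symbol f g) := by
  have h : (f : F) ≠ 0 ∧ (g : F) ≠ 0 := ⟨f.ne_zero, g.ne_zero⟩
  rw [symb, dif_pos h]
  simp

@[simp]
theorem symb_zero_left (g : F) : symb k 0 g = 0 := by
  rw [symb, dif_neg (by simp)]

@[simp]
theorem symb_zero_right (f : F) : symb k f 0 = 0 := by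
  rw [symb, dif_neg (by simp)]

theorem symb_mul_left {f g : F} (hf : f ≠ 0) (hg : g ≠ 0) (h : F) :
    symb k (f * g) h = symb k f h + symb k g h := by
  rcases eq_or_ne h 0 with rfl | hh
  · simp
  lift f to Fˣ using hf.isUnit
  lift g to Fˣ using hg.isUnit
  lift h to Fˣ using hh.isUnit
  rw [← Units.val_mul, symb_units, symb_units, symb_units, ← QuotientAddGroup.mk_add]
  congr 1
  simp only [MilnorK2.symbol, ofMul_mul, TensorProduct.add_tmul, Submodule.Quotient.mk_add]

theorem symb_mul_right {g h : F} (f : F) (hg : g ≠ 0) (hh : h ≠ 0) :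
    symb k f (g * h) = symb k f g + symb k f h := by
  rcases eq_or_ne f 0 with rfl | hf
  · simp
  lift f to Fˣ using hf.isUnit
  lift g to Fˣ using hg.isUnit
  lift h to Fˣ using hh.isUnit
  rw [← Units.val_mul, symb_units, symb_units, symb_units, ← QuotientAddGroup.mk_add]
  congr 1
  simp only [MilnorK2.symbol, ofMul_mul, TensorProduct.tmul_add, Submodule.Quotient.mk_add]

theorem symb_one_sub (f : F) : symb k f (1 - f) = 0 := by
  rcases eq_or_ne f 0 with rfl | hf
  · simp
  rcases eq_or_ne (1 - f) 0 with h | h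
  · simp [h]
  lift f to Fˣ using hf.isUnit
  have := symb_units (k := k) f (Units.mk0 _ h)
  rw [Units.val_mk0] at this
  rw [this]
  have hs : MilnorK2.symbol f (Units.mk0 _ h) = 0 :=
    (Submodule.Quotient.mk_eq_zero _).2 (Submodule.subset_span ⟨f, h, rfl⟩)
  rw [hs, QuotientAddGroup.mk_zero]

@[simp]
theorem symb_algebraMap_right (f : F) (c : k) : symb k f (algebraMap k F c) = 0 := by
  rcases eq_or_ne f 0 with rfl | hf
  · simp
  rcases eq_or_ne c 0 with rfl | hc
  · simp
  lift f to Fˣ using hf.isUnit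
  lift c to kˣ using hc.isUnit
  have := symb_units (k := k) f (Units.map (algebraMap k F).toMonoidHom c)
  simp only [RingHom.toMonoidHom_eq_coe, Units.coe_map, MonoidHom.coe_coe] at this
  rw [this]
  exact (QuotientAddGroup.eq_zero_iff _).2 (AddSubgroup.subset_closure ⟨f, c, rfl⟩)

@[simp]
theorem symb_one_right (f : F) : symb k f 1 = 0 := by
  simpa using symb_algebraMap_right f (1 : k)

theorem symb_neg_right (f g : F) : symb k f (-g) = symb k f g := by
  rcases eq_or_ne g 0 with rfl | hg
  · simp
  have := symb_algebraMap_right f (-1 : k)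
  rw [neg_eq_neg_one_mul, symb_mul_right f (by simp) hg]
  simpa using this

theorem symb_inv_left {f : F} (hf : f ≠ 0) (g : F) : symb k f⁻¹ g = -symb k f g := by
  have h := symb_mul_left (k := k) (inv_ne_zero hf) hf g
  have h1 := symb_mul_left (k := k) (one_ne_zero (α := F)) one_ne_zero g
  rw [inv_mul_cancel₀ hf] at h
  rw [one_mul, left_eq_add] at h1
  rw [h1] at h
  exact eq_neg_of_add_eq_zero_left h.symm

theorem symb_inv_right {g : F} (f : F) (hg : g ≠ 0) : symb k f g⁻¹ = -symb k f g := by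
  have h := symb_mul_right (k := k) f (inv_ne_zero hg) hg
  rw [inv_mul_cancel₀ hg, symb_one_right] at h
  exact eq_neg_of_add_eq_zero_left h.symm

@[simp]
theorem symb_self (f : F) : symb k f f = 0 := by
  rcases eq_or_ne f 0 with rfl | hf
  · simp
  rcases eq_or_ne f 1 with rfl | h1
  · simp
  have h1' : 1 - f ≠ 0 := sub_ne_zero.2 h1.symm
  have h2 : 1 - f⁻¹ ≠ 0 := sub_ne_zero.2 (by simpa [eq_comm, inv_eq_one] using h1)
  have h3 : symb k f (1 - f⁻¹) = 0 := by
    have := symb_one_sub (k := k) f⁻¹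
    rwa [symb_inv_left hf, neg_eq_zero] at this
  have h4 : -f * (1 - f⁻¹) = 1 - f := by field_simp; ring
  have h5 := symb_mul_right (k := k) f (neg_ne_zero.2 hf) h2
  rw [h4, symb_one_sub, h3, symb_neg_right, add_zero] at h5
  exact h5.symm

theorem symb_swap (f g : F) : symb k f g = -symb k g f := by
  rcases eq_or_ne f 0 with rfl | hf
  · simp
  rcases eq_or_ne g 0 with rfl | hg
  · simp
  have h := symb_self (k := k) (f * g)
  rw [symb_mul_left hf hg, symb_mul_right _ hf hg, symb_mul_right _ hf hg] at h
  simp only [symb_self, zero_add, add_zero] at h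
  exact eq_neg_of_add_eq_zero_left h

@[simp]
theorem symb_algebraMap_left (c : k) (f : F) : symb k (algebraMap k F c) f = 0 := by
  rw [symb_swap, symb_algebraMap_right, neg_zero]

theorem symb_eq_of_add_eq {f g h : F} (hf : f ≠ 0) (hg : g ≠ 0) (hh : h ≠ 0) (e : f + g = h) :
    symb k f g = symb k f h + symb k h g := by
  have h1 := symb_one_sub (k := k) (f * h⁻¹)
  have h2 : 1 - f * h⁻¹ = g * h⁻¹ := by
    field_simp
    rw [← e]; ring
  have hi := inv_ne_zero hh
  rw [h2, symb_mul_left hf hi, symb_mul_right _ hg hi, symb_mul_right _ hg hi,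
    symb_inv_left hh, symb_inv_left hh, symb_inv_right _ hh, symb_inv_right _ hh, symb_self] at h1
  rw [← sub_eq_zero, ← h1]
  abel

variable (k F) in
theorem closure_range_symb :
    AddSubgroup.closure (Set.range fun p : F × F => symb k p.1 p.2) = ⊤ := by
  rw [eq_top_iff]
  rintro x -
  induction x using QuotientAddGroup.induction_on with | H x
  obtain ⟨x, rfl⟩ := Submodule.Quotient.mk_surjective _ x
  induction x using TensorProduct.induction_on with
  | zero => exact AddSubgroup.zero_mem _
  | tmul f g =>
    refine AddSubgroup.subset_closure ⟨((f.toMul : Fˣ), (g.toMul : Fˣ)), ?_⟩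
    exact symb_units f.toMul g.toMul
  | add x y hx hy => exact AddSubgroup.add_mem _ hx hy

variable (k) in
theorem hom_ext {M : Type*} [AddGroup M] {φ ψ : K2ModConst k F →+ M}
    (h : ∀ f g : Fˣ, φ (symb k f g) = ψ (symb k f g)) : φ = ψ := by
  refine AddMonoidHom.eq_of_eqOn_dense (closure_range_symb k F) ?_
  rintro _ ⟨⟨f, g⟩, rfl⟩
  rcases eq_or_ne f 0 with rfl | hf
  · simp
  rcases eq_or_ne g 0 with rfl | hg
  · simp
  exact h (Units.mk0 f hf) (Units.mk0 g hg)

end Symbols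

section Lift

variable {k F : Type} [Field k] [Field F] [Algebra k F] {M : Type*} [AddCommGroup M]

/-- The universal property of `K₂(F)/Const`. -/
noncomputable def lift (k : Type) [Field k] [Algebra k F] (β : Additive Fˣ →+ Additive Fˣ →+ M)
    (hs : ∀ f g : Fˣ, (f : F) + g = 1 → β (.ofMul f) (.ofMul g) = 0)
    (hc : ∀ (f g : Fˣ) (c : k), algebraMap k F c = g → β (.ofMul f) (.ofMul g) = 0) :
    K2ModConst k F →+ M :=
  QuotientAddGroup.lift (constSymbols k F)
    ((steinberg F).liftQ
      (TensorProduct.liftAddHom β (fun r f g => by simp)).toIntLinearMap (by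
        refine Submodule.span_le.2 ?_
        rintro _ ⟨f, h, rfl⟩
        exact hs _ _ (by simp))).toAddMonoidHom (by
      refine (AddSubgroup.closure_le _).2 ?_
      rintro _ ⟨f, c, rfl⟩
      exact hc _ _ c rfl)

theorem lift_symb (β : Additive Fˣ →+ Additive Fˣ →+ M) (hs hc) (f g : Fˣ) :
    lift k β hs hc (symb k f g) = β (.ofMul f) (.ofMul g) := by
  rw [symb_units]
  rfl

end Lift

end K2ModConst

namespace K2ModConst

section Map

variable {k E F : Type} [Field k] [Field E] [Field F] [Algebra k E] [Algebra k F]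

/-- Functoriality of `K₂(F)/Const` in the extension `F` of `k`. -/
noncomputable def map (φ : E →ₐ[k] F) : K2ModConst k E →+ K2ModConst k F :=
  lift k
    (AddMonoidHom.mk' (fun f => AddMonoidHom.mk' (fun g => symb k (φ f.toMul) (φ g.toMul))
        fun a b => by simp [symb_mul_right])
      fun a b => by ext; simp [symb_mul_left])
    (fun f g h => by
      have : φ g = 1 - φ f := by rw [← map_one φ, ← h, map_add]; ring
      simp [this, symb_one_sub])
    (fun f g c h => by simp [← h])

@[simp]
theorem map_symb (φ : E →ₐ[k] F) (f g : E) : map φ (symb k f g) = symb k (φ f) (φ g) := by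
  rcases eq_or_ne f 0 with rfl | hf
  · simp
  rcases eq_or_ne g 0 with rfl | hg
  · simp
  exact lift_symb _ _ _ (Units.mk0 f hf) (Units.mk0 g hg)

end Map

section Dlog

variable {k F : Type} [Field k] [Field F] [Algebra k F]

/-- The logarithmic derivative of a derivation, as a homomorphism on units. -/
noncomputable def logDeriv {M : Type*} [AddCommGroup M] [Module k M] [Module F M]
    (D : Derivation k F M) : Additive Fˣ →+ M :=
  AddMonoidHom.mk' (fun f => ((f.toMul : Fˣ) : F)⁻¹ • D (f.toMul : Fˣ)) fun f g => by
    have hf := f.toMul.ne_zero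
    have hg := g.toMul.ne_zero
    simp only [toMul_add, Units.val_mul, Derivation.leibniz, smul_add, smul_smul]
    rw [add_comm]
    congr 2 <;> field_simp

@[simp]
theorem logDeriv_apply {M : Type*} [AddCommGroup M] [Module k M] [Module F M]
    (D : Derivation k F M) (f : Fˣ) : logDeriv D (.ofMul f) = (f : F)⁻¹ • D (f : F) := rfl

/-- The biadditive product of two additive maps into a ring. -/
noncomputable def mulHom {G R : Type*} [AddCommGroup G] [Ring R] (a b : G →+ R) : G →+ G →+ R :=
  ((AddMonoidHom.mul (R := R)).comp a).compl₂ b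

@[simp]
theorem mulHom_apply {G R : Type*} [AddCommGroup G] [Ring R] (a b : G →+ R) (x y : G) :
    mulHom a b x y = a x * b y := rfl

/-- A pair of derivations `D₁, D₂` of `F` over `k` gives the homomorphism
`{f, g} ↦ (D₁ f * D₂ g - D₂ f * D₁ g) / (f * g)`. -/
noncomputable def pairing (D₁ D₂ : Derivation k F F) : K2ModConst k F →+ F :=
  lift k
    (mulHom (logDeriv D₁) (logDeriv D₂) - mulHom (logDeriv D₂) (logDeriv D₁))
    (fun f g h => by
      have : (g : F) = 1 - f := by rw [← h]; ring
      simp [this]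
      ring)
    (fun f g c h => by simp [← h])

@[simp]
theorem pairing_symb (D₁ D₂ : Derivation k F F) (f g : F) :
    pairing D₁ D₂ (symb k f g) = (D₁ f * D₂ g - D₂ f * D₁ g) / (f * g) := by
  rcases eq_or_ne f 0 with rfl | hf
  · simp
  rcases eq_or_ne g 0 with rfl | hg
  · simp
  refine (lift_symb _ _ _ (Units.mk0 f hf) (Units.mk0 g hg)).trans ?_
  simp
  field_simp

open ExteriorAlgebra in
/-- The homomorphism `K₂(F)/Const → Ω²` sending `{f, g}` to `dlog f ∧ dlog g`. -/
noncomputable def dlogHom (k F : Type) [Field k] [Field F] [Algebra k F] :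
    K2ModConst k F →+ ExteriorAlgebra F (Ω[F⁄k]) :=
  lift k
    (mulHom ((ι F).toAddMonoidHom.comp (logDeriv (KaehlerDifferential.D k F)))
      ((ι F).toAddMonoidHom.comp (logDeriv (KaehlerDifferential.D k F))))
    (fun f g h => by
      have : (g : F) = 1 - f := by rw [← h]; ring
      simp [this])
    (fun f g c h => by simp [← h])

theorem dlogHom_symb (f g : F) : dlogHom k F (symb k f g) = dlogWedge k f g := by
  rcases eq_or_ne f 0 with rfl | hf
  · simp [dlogWedge, dlog]
  rcases eq_or_ne g 0 with rfl | hg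
  · simp [dlogWedge, dlog]
  exact lift_symb _ _ _ (Units.mk0 f hf) (Units.mk0 g hg)

theorem exists_linearMap_ι_mul_ι {R M : Type*} [CommRing R] [AddCommGroup M] [Module R M]
    (l₁ l₂ : M →ₗ[R] R) : ∃ ψ : ExteriorAlgebra R M →ₗ[R] R, ∀ a b,
      ψ (ExteriorAlgebra.ι R a * ExteriorAlgebra.ι R b) = l₁ a * l₂ b - l₂ a * l₁ b := by
  let A : M [⋀^Fin 2]→ₗ[R] R :=
    (Matrix.detRowAlternating (R := R) (n := Fin 2)).compLinearMap (LinearMap.pi ![l₁, l₂])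
  refine ⟨ExteriorAlgebra.liftAlternating (Pi.single 2 A), fun a b => ?_⟩
  have h := ExteriorAlgebra.liftAlternating_apply_ιMulti (R := R) (Pi.single 2 A) ![a, b]
  rw [ExteriorAlgebra.ιMulti_apply] at h
  simp only [List.ofFn_succ, List.ofFn_zero, List.prod_cons, List.prod_nil, mul_one] at h
  refine h.trans ?_
  rw [Pi.single_eq_same]
  refine (Matrix.det_fin_two _).trans ?_
  simp

theorem pairing_eq_zero_of_dlogHom_eq_zero {x : K2ModConst k F} (h : dlogHom k F x = 0)
    (D₁ D₂ : Derivation k F F) : pairing D₁ D₂ x = 0 := by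
  obtain ⟨ψ, hψ⟩ := exists_linearMap_ι_mul_ι D₁.liftKaehlerDifferential D₂.liftKaehlerDifferential
  have : pairing D₁ D₂ = ψ.toAddMonoidHom.comp (dlogHom k F) := by
    refine hom_ext k fun f g => ?_
    simp only [pairing_symb, AddMonoidHom.comp_apply, dlogHom_symb, dlogWedge, dlog]
    refine .trans ?_ (hψ _ _).symm
    have hf := f.ne_zero
    have hg := g.ne_zero
    simp only [map_smul, Derivation.liftKaehlerDifferential_comp_D, smul_eq_mul]
    field_simp
  rw [this, AddMonoidHom.comp_apply, h, map_zero]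

theorem pairing_map {k E F : Type} [Field k] [Field E] [Field F] [Algebra k E] [Algebra k F]
    (φ : E →ₐ[k] F) {d₁ d₂ : Derivation k E E} {D₁ D₂ : Derivation k F F}
    (h₁ : ∀ f, D₁ (φ f) = φ (d₁ f)) (h₂ : ∀ f, D₂ (φ f) = φ (d₂ f)) (x : K2ModConst k E) :
    pairing D₁ D₂ (map φ x) = φ (pairing d₁ d₂ x) := by
  have : (pairing D₁ D₂).comp (map φ) = φ.toRingHom.toAddMonoidHom.comp (pairing d₁ d₂) :=
    hom_ext k fun f g => by simp [h₁, h₂]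
  exact DFunLike.congr_fun this x

end Dlog

end K2ModConst

/-- Elements of `F` killed by all derivations over `k` are constants. -/
def DerivationsDetectConstants (k F : Type) [Field k] [Field F] [Algebra k F] : Prop :=
  ∀ f : F, (∀ D : Derivation k F F, D f = 0) → f ∈ Set.range (algebraMap k F)

/-- Elements of `K₂(F)/Const` are detected by the pairings with derivations. -/
def PairingsDetectSymbols (k F : Type) [Field k] [Field F] [Algebra k F] : Prop :=
  ∀ x : K2ModConst k F, (∀ D₁ D₂ : Derivation k F F, K2ModConst.pairing D₁ D₂ x = 0) → x = 0

section Transfer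

variable {k E F : Type} [Field k] [Field E] [Field F] [Algebra k E] [Algebra k F]

theorem exists_derivation_algEquiv (e : E ≃ₐ[k] F) (d : Derivation k E E) :
    ∃ D : Derivation k F F, ∀ f, D (e f) = e (d f) :=
  ⟨Derivation.mk' (e.toLinearMap ∘ₗ d.toLinearMap ∘ₗ e.symm.toLinearMap) fun a b => by
    change e (d (e.symm (a * b))) = a * e (d (e.symm b)) + b * e (d (e.symm a))
    simp, fun f => congrArg (fun x => e (d x)) (e.symm_apply_apply f)⟩

theorem DerivationsDetectConstants.of_algEquiv (h : DerivationsDetectConstants k E)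
    (e : E ≃ₐ[k] F) : DerivationsDetectConstants k F := by
  intro f hf
  obtain ⟨c, hc⟩ := h (e.symm f) fun d => by
    obtain ⟨D, hD⟩ := exists_derivation_algEquiv e d
    apply e.injective
    rw [← hD, e.apply_symm_apply, hf, map_zero]
  exact ⟨c, by rw [← e.apply_symm_apply f, ← hc, e.commutes]⟩

theorem PairingsDetectSymbols.of_algEquiv (h : PairingsDetectSymbols k E)
    (e : E ≃ₐ[k] F) : PairingsDetectSymbols k F := by
  intro x hx
  have hid : (K2ModConst.map (e : E →ₐ[k] F)).comp (K2ModConst.map (e.symm : F →ₐ[k] E)) =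
      .id _ := K2ModConst.hom_ext k fun f g => by simp
  have hx' := DFunLike.congr_fun hid x
  rw [AddMonoidHom.comp_apply, AddMonoidHom.id_apply] at hx'
  rw [← hx', h (K2ModConst.map _ x), map_zero]
  intro d₁ d₂
  obtain ⟨D₁, h₁⟩ := exists_derivation_algEquiv e d₁
  obtain ⟨D₂, h₂⟩ := exists_derivation_algEquiv e d₂
  apply e.injective
  have := K2ModConst.pairing_map (e : E →ₐ[k] F) h₁ h₂ (K2ModConst.map (e.symm : F →ₐ[k] E) x)
  rw [hx', hx] at this
  rw [map_zero]
  exact this.symm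

theorem derivationsDetectConstants_self (k : Type) [Field k] : DerivationsDetectConstants k k :=
  fun f _ => ⟨f, rfl⟩

theorem pairingsDetectSymbols_self (k : Type) [Field k] : PairingsDetectSymbols k k := by
  intro x _
  have : AddMonoidHom.id (K2ModConst k k) = 0 := K2ModConst.hom_ext k fun f g =>
    K2ModConst.symb_algebraMap_right (k := k) (f : k) (g : k)
  exact DFunLike.congr_fun this x

end Transfer

section PolynomialDerivations

open Polynomial

variable {k E : Type} [Field k] [Field E] [Algebra k E]

/-- The extension of a derivation of `E` to `E[X]` acting on coefficients. -/
noncomputable def Derivation.mapPolynomial (d : Derivation k E E) : Derivation k E[X] E[X] :=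
  PolynomialModule.equivPolynomialSelf.compDer d.mapCoeffs

theorem Derivation.coeff_mapPolynomial (d : Derivation k E E) (p : E[X]) (i : ℕ) :
    (d.mapPolynomial p).coeff i = d (p.coeff i) := rfl

theorem Derivation.mapPolynomial_C (d : Derivation k E E) (a : E) :
    d.mapPolynomial (C a) = C (d a) := by
  ext i
  rw [Derivation.coeff_mapPolynomial, coeff_C, coeff_C]
  split_ifs <;> simp

theorem Derivation.mapPolynomial_monomial (d : Derivation k E E) (n : ℕ) (a : E) :
    d.mapPolynomial (monomial n a) = monomial n (d a) := by
  ext i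
  rw [Derivation.coeff_mapPolynomial, coeff_monomial, coeff_monomial]
  split_ifs <;> simp

theorem Derivation.mapPolynomial_comp (d : Derivation k E E) (m g : E[X]) :
    d.mapPolynomial (m.comp g) =
      (d.mapPolynomial m).comp g + (derivative m).comp g * d.mapPolynomial g := by
  induction m using Polynomial.induction_on' with
  | add p q hp hq => simp only [add_comp, map_add, hp, hq]; ring
  | monomial n a =>
    simp only [monomial_comp, Derivation.leibniz, Derivation.leibniz_pow, mapPolynomial_C,
      mapPolynomial_monomial, derivative_monomial, smul_eq_mul, C_mul, C_eq_natCast,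
      nsmul_eq_mul]
    ring

/-- A derivation of a domain extends to its field of fractions. -/
theorem exists_derivation_isFractionRing {S F : Type} [CommRing S] [Field F]
    [Algebra k S] [Algebra k F] [Algebra S F] [IsScalarTower k S F] [IsFractionRing S F]
    (d : Derivation k S S) :
    ∃ D : Derivation k F F, ∀ s, D (algebraMap S F s) = algebraMap S F (d s) := by
  have : Algebra.FormallyEtale S F := .of_isLocalization (nonZeroDivisors S)
  let d' : Derivation k S F := (Algebra.linearMap S F).compDer d
  let l : Ω[F⁄k] →ₗ[F] F := (d'.liftKaehlerDifferential.liftBaseChange F) ∘ₗ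
    (KaehlerDifferential.tensorKaehlerEquivOfFormallyEtale k S F).symm.toLinearMap
  refine ⟨l.compDer (KaehlerDifferential.D k F), fun s => ?_⟩
  change l (KaehlerDifferential.D k F (algebraMap S F s)) = _
  simp only [l, LinearMap.comp_apply, LinearEquiv.coe_coe,
    KaehlerDifferential.tensorKaehlerEquivOfFormallyEtale_symm_D_algebraMap]
  simp [d']

variable [CharZero E]

/-- If the derivations of `E` over `k`, extended to `E[X]/(π)`, all kill the class of `g`, then
`g` is constant. -/
theorem exists_eq_C_of_forall_dvd [IsAlgClosed k] (hE : DerivationsDetectConstants k E)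
    {π g : E[X]} (hπ : Irreducible π) (hg : g.natDegree < π.natDegree)
    (h : ∀ d : Derivation k E E,
      π ∣ d.mapPolynomial π * derivative g - derivative π * d.mapPolynomial g) :
    ∃ c : k, g = C (algebraMap k E c) := by
  have : Fact (Irreducible π) := ⟨hπ⟩
  have haeval (r : E[X]) : aeval (AdjoinRoot.mk π g) r = AdjoinRoot.mk π (r.comp g) := by
    rw [comp_eq_aeval]
    exact aeval_algHom_apply (AdjoinRoot.mkₐ π) g r
  have : Module.Finite E (AdjoinRoot π) := (AdjoinRoot.powerBasis hπ.ne_zero).finite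
  have hint : IsIntegral E (AdjoinRoot.mk π g) := .of_finite _ _
  set m := minpoly E (AdjoinRoot.mk π g) with hm
  have hmonic : m.Monic := minpoly.monic hint
  have hdvd : π ∣ m.comp g := by
    rw [← AdjoinRoot.mk_eq_zero, ← haeval]
    exact minpoly.aeval _ _
  have hπ' : ¬ π ∣ derivative π := by
    intro h0
    have h1 := eq_zero_of_dvd_of_natDegree_lt h0 (natDegree_derivative_lt (Nat.ne_zero_of_lt hg))
    have := derivative_eq_zero.1 h1
    omega
  have hcoeff (d : Derivation k E E) : d.mapPolynomial m = 0 := by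
    by_contra hne
    obtain ⟨q, hq⟩ := hdvd
    have h1 := congrArg d.mapPolynomial hq
    have h2 := congrArg derivative hq
    rw [Derivation.mapPolynomial_comp, Derivation.leibniz, smul_eq_mul, smul_eq_mul] at h1
    rw [derivative_comp, derivative_mul] at h2
    obtain ⟨r, hr⟩ := h d
    have h3 : π ∣ derivative π * (d.mapPolynomial m).comp g := by
      refine ⟨derivative π * d.mapPolynomial q - d.mapPolynomial π * derivative q +
        (derivative m).comp g * r, ?_⟩
      linear_combination derivative π * h1 - d.mapPolynomial π * h2 + (derivative m).comp g * hr
    have h4 := (hπ.prime.dvd_or_dvd h3).resolve_left hπ'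
    rw [← AdjoinRoot.mk_eq_zero, ← haeval] at h4
    refine (minpoly.degree_le_of_ne_zero E _ hne h4).not_gt ?_
    rw [← hm, degree_eq_natDegree hmonic.ne_zero, degree_lt_iff_coeff_zero]
    intro i hi
    rw [Derivation.coeff_mapPolynomial]
    rcases hi.eq_or_lt with rfl | hi
    · rw [hmonic.coeff_natDegree, Derivation.map_one_eq_zero]
    · rw [coeff_eq_zero_of_natDegree_lt hi, map_zero]
  have hlift : m ∈ lifts (algebraMap k E) := by
    rw [lifts_iff_coeff_lifts]
    intro i
    refine hE _ fun d => ?_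
    rw [← Derivation.coeff_mapPolynomial, hcoeff, coeff_zero]
  obtain ⟨m₀, hm₀⟩ := (mem_lifts _).1 hlift
  obtain ⟨c, hc⟩ := IsAlgClosed.exists_root m₀ (by
    rw [← degree_map m₀ (algebraMap k E), hm₀]
    exact (minpoly.degree_pos hint).ne')
  have hroot : m.IsRoot (algebraMap k E c) := by
    rw [← hm₀]
    exact hc.map
  have h5 := minpoly.root hint hroot
  refine ⟨c, ?_⟩
  rw [← sub_eq_zero]
  refine eq_zero_of_dvd_of_natDegree_lt (p := π) ?_ ?_
  · rw [← AdjoinRoot.mk_eq_zero, map_sub, ← h5, sub_eq_zero]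
    rfl
  · rwa [natDegree_sub_C]

/-- The derivations over `k` of a rational function field in one variable over `E` detect
constants if those of `E` do. -/
theorem DerivationsDetectConstants.of_isFractionRing_polynomial {F : Type} [Field F] [Algebra k F]
    [Algebra E[X] F] [IsScalarTower k E[X] F] [IsFractionRing E[X] F]
    (hE : DerivationsDetectConstants k E) : DerivationsDetectConstants k F := by
  intro f hf
  have hinj := IsFractionRing.injective E[X] F
  obtain ⟨p, ⟨q, hq⟩, hcop, hpq⟩ := IsFractionRing.exists_reduced_fraction (A := E[X]) f
  have hq0 : q ≠ 0 := nonZeroDivisors.ne_zero hq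
  rw [IsFractionRing.mk'_eq_div] at hpq
  have hq0' : algebraMap E[X] F q ≠ 0 := (map_ne_zero_iff _ hinj).2 hq0
  have hfq : f * algebraMap E[X] F q = algebraMap E[X] F p := by
    rw [← hpq, div_mul_cancel₀ _ hq0']
  obtain ⟨D, hD⟩ := exists_derivation_isFractionRing (F := F)
    ((derivative' (R := E)).restrictScalars k)
  have h1 := congrArg D hfq
  rw [Derivation.leibniz, hf, smul_zero, add_zero, hD, hD, smul_eq_mul] at h1
  have h2 : p * derivative q = derivative p * q := by
    apply hinj
    rw [map_mul, map_mul, ← hfq, mul_right_comm]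
    exact congrArg (· * _) h1
  have h3 : derivative q = 0 := by
    have h4 : q ∣ derivative q := hcop.symm.dvd_of_dvd_mul_left ⟨derivative p, by rw [h2, mul_comm]⟩
    by_contra hne
    exact hne (eq_zero_of_dvd_of_degree_lt h4 (degree_derivative_lt hq0))
  have h5 : derivative p = 0 := by
    rw [h3, mul_zero, eq_comm, mul_eq_zero] at h2
    exact h2.resolve_right hq0
  rw [eq_C_of_derivative_eq_zero h3] at hfq hq0
  rw [eq_C_of_derivative_eq_zero h5] at hfq
  set b := q.coeff 0
  set a := p.coeff 0
  have hb : b ≠ 0 := C_ne_zero.1 hq0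
  have hfab : f = algebraMap E[X] F (C (a / b)) := by
    rw [← mul_left_inj' ((map_ne_zero_iff _ hinj).2 hq0), hfq, ← map_mul, ← C_mul,
      div_mul_cancel₀ _ hb]
  obtain ⟨c, hc⟩ := hE (a / b) fun d => by
    obtain ⟨D, hD⟩ := exists_derivation_isFractionRing (F := F) d.mapPolynomial
    have := hf D
    rwa [hfab, hD, Derivation.mapPolynomial_C, map_eq_zero_iff _ hinj, C_eq_zero] at this
  exact ⟨c, by rw [hfab, ← hc, IsScalarTower.algebraMap_apply k E[X] F]; rfl⟩

end PolynomialDerivations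

section DegreeFiltration

open Polynomial K2ModConst

variable (k : Type) {E : Type} (F : Type) [Field k] [Field E] [Field F] [Algebra k E] [Algebra k F]
  [Algebra E[X] F] [IsScalarTower k E[X] F] [IsFractionRing E[X] F]

/-- The class of the symbol of two polynomials. -/
noncomputable def polySymb (p q : E[X]) : K2ModConst k F :=
  symb k (algebraMap E[X] F p) (algebraMap E[X] F q)

/-- The subgroup generated by the symbols of polynomials of degree at most `n`. -/
noncomputable def degreeFiltration (E F : Type) [Field E] [Field F] [Algebra k F]
    [Algebra E[X] F] (n : ℕ) : AddSubgroup (K2ModConst k F) :=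
  AddSubgroup.closure {x | ∃ p q : E[X], p.natDegree ≤ n ∧ q.natDegree ≤ n ∧ polySymb k F p q = x}

variable {k F}

omit [Algebra k E] [IsScalarTower k E[X] F] [IsFractionRing E[X] F] in
theorem polySymb_mem {n : ℕ} {p q : E[X]} (hp : p.natDegree ≤ n) (hq : q.natDegree ≤ n) :
    polySymb k F p q ∈ degreeFiltration k E F n :=
  AddSubgroup.subset_closure ⟨p, q, hp, hq, rfl⟩

omit [Algebra k E] [IsScalarTower k E[X] F] [IsFractionRing E[X] F] in
theorem degreeFiltration_le {m n : ℕ} (h : m ≤ n) :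
    degreeFiltration k E F m ≤ degreeFiltration k E F n :=
  AddSubgroup.closure_mono fun _ ⟨p, q, hp, hq, e⟩ => ⟨p, q, hp.trans h, hq.trans h, e⟩

omit [Algebra k E] [IsScalarTower k E[X] F] in
theorem algebraMap_polynomial_ne_zero {p : E[X]} (hp : p ≠ 0) : algebraMap E[X] F p ≠ 0 :=
  (map_ne_zero_iff _ (IsFractionRing.injective E[X] F)).2 hp

omit [Algebra k E] [IsScalarTower k E[X] F] in
theorem polySymb_mul_left {p q : E[X]} (hp : p ≠ 0) (hq : q ≠ 0) (r : E[X]) :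
    polySymb k F (p * q) r = polySymb k F p r + polySymb k F q r := by
  rw [polySymb, map_mul, symb_mul_left (algebraMap_polynomial_ne_zero hp)
    (algebraMap_polynomial_ne_zero hq)]
  rfl

omit [Algebra k E] [IsScalarTower k E[X] F] in
theorem polySymb_mul_right (p : E[X]) {q r : E[X]} (hq : q ≠ 0) (hr : r ≠ 0) :
    polySymb k F p (q * r) = polySymb k F p q + polySymb k F p r := by
  rw [polySymb, map_mul, symb_mul_right _ (algebraMap_polynomial_ne_zero hq)
    (algebraMap_polynomial_ne_zero hr)]
  rfl

omit [Algebra k E] [IsScalarTower k E[X] F] [IsFractionRing E[X] F] in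
theorem polySymb_swap (p q : E[X]) : polySymb k F p q = -polySymb k F q p := symb_swap _ _

omit [Algebra k E] [IsScalarTower k E[X] F] [IsFractionRing E[X] F] in
@[simp]
theorem polySymb_self (p : E[X]) : polySymb k F p p = 0 := symb_self _

omit [Algebra k E] [IsScalarTower k E[X] F] [IsFractionRing E[X] F] in
@[simp]
theorem polySymb_zero_left (p : E[X]) : polySymb k F 0 p = 0 := by simp [polySymb]

omit [Algebra k E] [IsScalarTower k E[X] F] [IsFractionRing E[X] F] in
@[simp]
theorem polySymb_zero_right (p : E[X]) : polySymb k F p 0 = 0 := by simp [polySymb]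

omit [Algebra k E] [IsScalarTower k E[X] F] [IsFractionRing E[X] F] in
@[simp]
theorem polySymb_one_right (p : E[X]) : polySymb k F p 1 = 0 := by simp [polySymb]

omit [IsFractionRing E[X] F] in
theorem polySymb_C_algebraMap (p : E[X]) (c : k) :
    polySymb k F p (C (algebraMap k E c)) = 0 := by
  have : algebraMap E[X] F (C (algebraMap k E c)) = algebraMap k F c :=
    (IsScalarTower.algebraMap_apply k E[X] F c).symm
  rw [polySymb, this, symb_algebraMap_right]

omit [Algebra k E] [IsScalarTower k E[X] F] in
theorem polySymb_eq_of_add_eq {p q r : E[X]} (hp : p ≠ 0) (hq : q ≠ 0) (hr : r ≠ 0)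
    (e : p + q = r) : polySymb k F p q = polySymb k F p r + polySymb k F r q :=
  symb_eq_of_add_eq (algebraMap_polynomial_ne_zero hp) (algebraMap_polynomial_ne_zero hq)
    (algebraMap_polynomial_ne_zero hr) (by rw [← map_add, e])

omit [Algebra k E] [IsScalarTower k E[X] F] in
/-- Modulo symbols of polynomials of lower degree, `{π, g}` depends multiplicatively on the class
of `g` modulo `π`. -/
theorem polySymb_add_sub_mem {n : ℕ} {π g h q r : E[X]} (hπ : π.natDegree = n + 1)
    (hg : g ≠ 0) (hh : h ≠ 0) (hr : r ≠ 0) (hgn : g.natDegree ≤ n) (hhn : h.natDegree ≤ n)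
    (hrn : r.natDegree ≤ n) (e : q * π + r = g * h) :
    polySymb k F π g + polySymb k F π h - polySymb k F π r ∈ degreeFiltration k E F n := by
  have hπ0 : π ≠ 0 := by rintro rfl; simp at hπ
  rw [← polySymb_mul_right π hg hh]
  rcases eq_or_ne q 0 with rfl | hq
  · rw [← e, zero_mul, zero_add, sub_self]
    exact zero_mem _
  have hqn : q.natDegree ≤ n := by
    have h1 : q * π = g * h - r := by rw [← e]; ring
    have h2 := congrArg natDegree h1
    rw [natDegree_mul hq hπ0] at h2
    have h3 := natDegree_sub_le (g * h) r
    rw [natDegree_mul hg hh] at h3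
    omega
  have h1 := polySymb_eq_of_add_eq (k := k) (F := F) (mul_ne_zero hq hπ0) hr
    (mul_ne_zero hg hh) e
  rw [polySymb_mul_left hq hπ0, polySymb_mul_left hq hπ0, polySymb_mul_left hg hh,
    polySymb_mul_right q hg hh] at h1
  have h2 : polySymb k F π (g * h) - polySymb k F π r =
      polySymb k F q r - (polySymb k F q g + polySymb k F q h) -
        (polySymb k F g r + polySymb k F h r) := by
    rw [← sub_eq_zero, ← sub_eq_zero.2 h1.symm]
    abel
  rw [h2]
  exact sub_mem (sub_mem (polySymb_mem hqn hrn) (add_mem (polySymb_mem hqn hgn)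
    (polySymb_mem hqn hhn))) (add_mem (polySymb_mem hgn hrn) (polySymb_mem hhn hrn))

variable (k F) in
/-- For `π` irreducible of degree `n + 1`, the classes which are of the form `{π, g}` modulo
symbols of polynomials of degree at most `n`. -/
noncomputable def irreducibleSymbols (n : ℕ) (π : E[X]) (hπ : Irreducible π)
    (hn : π.natDegree = n + 1) : AddSubgroup (K2ModConst k F) where
  carrier := {x | ∃ g : E[X], g ≠ 0 ∧ g.natDegree ≤ n ∧
    x - polySymb k F π g ∈ degreeFiltration k E F n}
  zero_mem' := ⟨1, one_ne_zero, by simp, by simp⟩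
  add_mem' := by
    rintro x y ⟨g, hg, hgn, hx⟩ ⟨h, hh, hhn, hy⟩
    have hr : g * h % π ≠ 0 := by
      rw [Ne, EuclideanDomain.mod_eq_zero]
      intro hdvd
      rcases hπ.prime.dvd_or_dvd hdvd with h1 | h1
      · exact hg (eq_zero_of_dvd_of_natDegree_lt h1 (by omega))
      · exact hh (eq_zero_of_dvd_of_natDegree_lt h1 (by omega))
    have hrn : (g * h % π).natDegree ≤ n := by
      have := natDegree_mod_lt (g * h) (q := π) (by omega)
      omega
    refine ⟨g * h % π, hr, hrn, ?_⟩
    have := polySymb_add_sub_mem (k := k) (F := F) hn hg hh hr hgn hhn hrn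
      (q := g * h / π) (by rw [mul_comm]; exact EuclideanDomain.div_add_mod _ _)
    convert add_mem (add_mem hx hy) this using 1
    abel
  neg_mem' := by
    rintro x ⟨g, hg, hgn, hx⟩
    have hcop : IsCoprime π g := hπ.coprime_iff_not_dvd.2 fun h1 =>
      hg (eq_zero_of_dvd_of_natDegree_lt h1 (by omega))
    obtain ⟨u, v, huv⟩ := hcop
    have hdiv := EuclideanDomain.div_add_mod v π
    have e : -(u + v / π * g) * π + 1 = g * (v % π) := by
      linear_combination -g * hdiv - huv
    have hr : v % π ≠ 0 := by
      intro h0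
      rw [h0, mul_zero] at e
      exact hπ.not_isUnit (IsUnit.of_mul_eq_one (u + v / π * g) (by linear_combination -e))
    have hrn : (v % π).natDegree ≤ n := by
      have := natDegree_mod_lt v (q := π) (by omega)
      omega
    refine ⟨v % π, hr, hrn, ?_⟩
    have := polySymb_add_sub_mem (k := k) (F := F) hn hg hr one_ne_zero hgn hrn (by simp) e
    rw [polySymb_one_right, sub_zero] at this
    convert sub_mem (neg_mem hx) this using 1
    abel

variable (k E F) in
/-- The subgroup generated by symbols `{p, q}` of degree at most `n` and by the symbols `{π, g}`
with `π` monic irreducible of degree `n + 1` and `g` of degree at most `n`. -/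
noncomputable def monicFiltration (n : ℕ) : AddSubgroup (K2ModConst k F) :=
  degreeFiltration k E F n ⊔
    ⨆ π : {π : E[X] // π.Monic ∧ Irreducible π ∧ π.natDegree = n + 1},
      irreducibleSymbols k F n π.1 π.2.2.1 π.2.2.2

omit [Algebra k E] [IsScalarTower k E[X] F] in
theorem polySymb_mem_monicFiltration_left {n : ℕ} {p q : E[X]} (hp : p.natDegree ≤ n + 1)
    (hq : q.natDegree ≤ n) : polySymb k F p q ∈ monicFiltration k E F n := by
  have hle : degreeFiltration k E F n ≤ monicFiltration k E F n := le_sup_left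
  rcases eq_or_ne q 0 with rfl | hq0
  · simp
  rcases eq_or_ne p 0 with rfl | hp0
  · simp
  rcases hp.lt_or_eq with hp | hp
  · exact hle (polySymb_mem (by omega) hq)
  have hpu : ¬ IsUnit p := fun h => by
    have := natDegree_eq_zero_of_isUnit h
    omega
  by_cases hirr : Irreducible p
  · have hlc : p.leadingCoeff⁻¹ ≠ 0 := inv_ne_zero (leadingCoeff_ne_zero.2 hp0)
    have hC : C p.leadingCoeff ≠ 0 := C_ne_zero.2 (leadingCoeff_ne_zero.2 hp0)
    have hmonic : (p * C p.leadingCoeff⁻¹).Monic := monic_mul_leadingCoeff_inv hp0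
    have hπ : Irreducible (p * C p.leadingCoeff⁻¹) :=
      (associated_mul_unit_right p _ (isUnit_C.2 hlc.isUnit)).irreducible hirr
    have hn : (p * C p.leadingCoeff⁻¹).natDegree = n + 1 := by
      rw [natDegree_mul_C hlc, hp]
    have e : p = C p.leadingCoeff * (p * C p.leadingCoeff⁻¹) := by
      rw [mul_left_comm, ← C_mul, mul_inv_cancel₀ (leadingCoeff_ne_zero.2 hp0), C_1, mul_one]
    rw [e, polySymb_mul_left hC hmonic.ne_zero]
    refine add_mem (hle (polySymb_mem (by simp) hq)) ?_
    refine (le_sup_right : _ ≤ monicFiltration k E F n) ?_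
    refine (le_iSup (fun π : {π : E[X] // π.Monic ∧ Irreducible π ∧ π.natDegree = n + 1} =>
      irreducibleSymbols k F n π.1 π.2.2.1 π.2.2.2) ⟨_, hmonic, hπ, hn⟩) ?_
    exact ⟨q, hq0, hq, by simp⟩
  · obtain ⟨a, b, hab, ha, hb⟩ : ∃ a b : E[X], p = a * b ∧ ¬ IsUnit a ∧ ¬ IsUnit b := by
      simpa [irreducible_iff, hpu] using hirr
    subst hab
    obtain ⟨ha0, hb0⟩ := mul_ne_zero_iff.1 hp0
    have ha1 : 0 < a.natDegree :=
      natDegree_pos_iff_degree_pos.2 (degree_pos_of_ne_zero_of_nonunit ha0 ha)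
    have hb1 : 0 < b.natDegree :=
      natDegree_pos_iff_degree_pos.2 (degree_pos_of_ne_zero_of_nonunit hb0 hb)
    rw [natDegree_mul ha0 hb0] at hp
    rw [polySymb_mul_left ha0 hb0]
    exact add_mem (hle (polySymb_mem (by omega) hq)) (hle (polySymb_mem (by omega) hq))

omit [Algebra k E] [IsScalarTower k E[X] F] in
theorem degreeFiltration_succ_le (n : ℕ) :
    degreeFiltration k E F (n + 1) ≤ monicFiltration k E F n := by
  refine (AddSubgroup.closure_le _).2 ?_
  rintro _ ⟨p, q, hp, hq, rfl⟩
  have hright {p q : E[X]} (hp : p.natDegree ≤ n) (hq : q.natDegree ≤ n + 1) :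
      polySymb k F p q ∈ monicFiltration k E F n := by
    rw [polySymb_swap]
    exact neg_mem (polySymb_mem_monicFiltration_left hq hp)
  rcases hq.lt_or_eq with hq | hq
  · exact polySymb_mem_monicFiltration_left hp (by omega)
  rcases hp.lt_or_eq with hp | hp
  · exact hright (by omega) hq.le
  have hp0 : p ≠ 0 := by rintro rfl; simp at hp
  have hq0 : q ≠ 0 := by rintro rfl; simp at hq
  have hc : p.leadingCoeff / q.leadingCoeff ≠ 0 :=
    div_ne_zero (leadingCoeff_ne_zero.2 hp0) (leadingCoeff_ne_zero.2 hq0)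
  set c := p.leadingCoeff / q.leadingCoeff
  have hC : C c ≠ 0 := C_ne_zero.2 hc
  have hCq : (C c * q).natDegree = n + 1 := by rw [natDegree_C_mul hc, hq]
  have hC0 : (C c).natDegree ≤ n := by simp
  rcases eq_or_ne (p - C c * q) 0 with h0 | h0
  · rw [sub_eq_zero.1 h0, polySymb_mul_left hC hq0, polySymb_self, add_zero]
    exact hright hC0 hq.le
  have hr : (p - C c * q).natDegree ≤ n := by
    have : (p - C c * q).degree < p.degree := by
      refine degree_sub_lt_left ?_ hp0 ?_
      · rw [degree_eq_natDegree hp0, degree_eq_natDegree (mul_ne_zero hC hq0), hCq, hp]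
      · rw [leadingCoeff_mul, leadingCoeff_C, div_mul_cancel₀ _ (leadingCoeff_ne_zero.2 hq0)]
    have := natDegree_lt_natDegree h0 this
    omega
  have h1 := polySymb_eq_of_add_eq (k := k) (F := F) (mul_ne_zero hC hq0) h0 hp0
    (by ring : C c * q + (p - C c * q) = p)
  rw [polySymb_mul_left (r := p) hC hq0, polySymb_swap q p] at h1
  have h2 : polySymb k F p q = polySymb k F (C c) p + polySymb k F p (p - C c * q) -
      polySymb k F (C c * q) (p - C c * q) := by
    rw [h1]
    abel
  rw [h2]
  exact sub_mem (add_mem (hright hC0 hp.le) (polySymb_mem_monicFiltration_left hp.le hr))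
    (polySymb_mem_monicFiltration_left hCq.le hr)

omit [Algebra k E] [IsScalarTower k E[X] F] in
theorem exists_mem_degreeFiltration (x : K2ModConst k F) :
    ∃ n, x ∈ degreeFiltration k E F n := by
  have hx : x ∈ AddSubgroup.closure (Set.range fun p : F × F => symb k p.1 p.2) := by
    rw [closure_range_symb]
    trivial
  induction hx using AddSubgroup.closure_induction with
  | mem x hx =>
    obtain ⟨⟨f, g⟩, rfl⟩ := hx
    obtain ⟨a, b, hb, rfl⟩ := IsFractionRing.div_surjective (A := E[X]) f
    obtain ⟨c, d, hd, rfl⟩ := IsFractionRing.div_surjective (A := E[X]) g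
    have hb0 := algebraMap_polynomial_ne_zero (F := F) (nonZeroDivisors.ne_zero hb)
    have hd0 := algebraMap_polynomial_ne_zero (F := F) (nonZeroDivisors.ne_zero hd)
    rcases eq_or_ne a 0 with rfl | ha
    · exact ⟨0, by simp⟩
    rcases eq_or_ne c 0 with rfl | hc
    · exact ⟨0, by simp⟩
    have ha0 := algebraMap_polynomial_ne_zero (F := F) ha
    have hc0 := algebraMap_polynomial_ne_zero (F := F) hc
    refine ⟨a.natDegree + b.natDegree + c.natDegree + d.natDegree, ?_⟩
    simp only [div_eq_mul_inv]
    rw [symb_mul_left ha0 (inv_ne_zero hb0), symb_mul_right _ hc0 (inv_ne_zero hd0),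
      symb_mul_right _ hc0 (inv_ne_zero hd0), symb_inv_left hb0, symb_inv_left hb0,
      symb_inv_right _ hd0, symb_inv_right _ hd0]
    exact add_mem
      (add_mem (polySymb_mem (by omega) (by omega)) (neg_mem (polySymb_mem (by omega) (by omega))))
      (add_mem (neg_mem (polySymb_mem (by omega) (by omega)))
        (neg_mem (neg_mem (polySymb_mem (by omega) (by omega)))))
  | zero => exact ⟨0, zero_mem _⟩
  | add x y _ _ hx hy =>
    obtain ⟨m, hm⟩ := hx
    obtain ⟨n, hn⟩ := hy
    exact ⟨max m n, add_mem (degreeFiltration_le (le_max_left _ _) hm)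
      (degreeFiltration_le (le_max_right _ _) hn)⟩
  | neg x _ hx =>
    obtain ⟨m, hm⟩ := hx
    exact ⟨m, neg_mem hm⟩

end DegreeFiltration

section Residues

open Polynomial K2ModConst

variable {k E F : Type} [Field k] [Field E] [Field F] [Algebra k E] [Algebra k F]
  [Algebra E[X] F] [IsScalarTower k E[X] F] [IsFractionRing E[X] F]

/-- The elements of the fraction field of `E[X]` which are regular at a prime `π`. -/
def regularAt (F : Type) {E : Type} [Field E] [Field F] [Algebra E[X] F] (π : E[X])
    (hπ : Prime π) : AddSubgroup F where
  carrier := {z | ∃ a b : E[X], ¬ π ∣ b ∧ z * algebraMap E[X] F b = algebraMap E[X] F a}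
  zero_mem' := ⟨0, 1, hπ.not_dvd_one, by simp⟩
  add_mem' := by
    rintro x y ⟨a, b, hb, hx⟩ ⟨c, d, hd, hy⟩
    refine ⟨a * d + c * b, b * d, fun h => (hπ.dvd_or_dvd h).elim hb hd, ?_⟩
    simp only [map_add, map_mul, ← hx, ← hy]
    ring
  neg_mem' := by
    rintro x ⟨a, b, hb, hx⟩
    exact ⟨-a, b, hb, by rw [map_neg, ← hx, neg_mul]⟩

omit [IsScalarTower k E[X] F] in
theorem pairing_polySymb {D₁ D₂ : Derivation k F F} {d₁ d₂ : Derivation k E[X] E[X]}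
    (h₁ : ∀ p, D₁ (algebraMap E[X] F p) = algebraMap E[X] F (d₁ p))
    (h₂ : ∀ p, D₂ (algebraMap E[X] F p) = algebraMap E[X] F (d₂ p))
    {p q : E[X]} (hp : p ≠ 0) (hq : q ≠ 0) :
    pairing D₁ D₂ (polySymb k F p q) * algebraMap E[X] F (p * q) =
      algebraMap E[X] F (d₁ p * d₂ q - d₂ p * d₁ q) := by
  have hp' := algebraMap_polynomial_ne_zero (F := F) hp
  have hq' := algebraMap_polynomial_ne_zero (F := F) hq
  rw [polySymb, pairing_symb, h₁, h₁, h₂, h₂, map_mul, div_mul_cancel₀ _ (mul_ne_zero hp' hq')]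
  simp

omit [IsScalarTower k E[X] F] in
theorem pairing_polySymb_mem_regularAt {D₁ D₂ : Derivation k F F} {d₁ d₂ : Derivation k E[X] E[X]}
    (h₁ : ∀ p, D₁ (algebraMap E[X] F p) = algebraMap E[X] F (d₁ p))
    (h₂ : ∀ p, D₂ (algebraMap E[X] F p) = algebraMap E[X] F (d₂ p))
    {π p q : E[X]} (hπ : Prime π) (hp : ¬ π ∣ p) (hq : ¬ π ∣ q) :
    pairing D₁ D₂ (polySymb k F p q) ∈ regularAt F π hπ :=
  ⟨_, p * q, fun h => (hπ.dvd_or_dvd h).elim hp hq,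
    pairing_polySymb h₁ h₂ (fun h => hp (h ▸ dvd_zero _)) (fun h => hq (h ▸ dvd_zero _))⟩

omit [IsScalarTower k E[X] F] in
theorem pairing_mem_regularAt_of_mem_degreeFiltration {D₁ D₂ : Derivation k F F}
    {d₁ d₂ : Derivation k E[X] E[X]}
    (h₁ : ∀ p, D₁ (algebraMap E[X] F p) = algebraMap E[X] F (d₁ p))
    (h₂ : ∀ p, D₂ (algebraMap E[X] F p) = algebraMap E[X] F (d₂ p))
    {π : E[X]} (hπ : Prime π) {n : ℕ} (hn : n < π.natDegree) {x : K2ModConst k F}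
    (hx : x ∈ degreeFiltration k E F n) : pairing D₁ D₂ x ∈ regularAt F π hπ := by
  have : degreeFiltration k E F n ≤ (regularAt F π hπ).comap (pairing D₁ D₂) := by
    refine (AddSubgroup.closure_le _).2 ?_
    rintro _ ⟨p, q, hp, hq, rfl⟩
    rcases eq_or_ne p 0 with rfl | hp0
    · simp
    rcases eq_or_ne q 0 with rfl | hq0
    · simp
    exact pairing_polySymb_mem_regularAt h₁ h₂ hπ
      (fun h => hp0 (eq_zero_of_dvd_of_natDegree_lt h (by omega)))
      (fun h => hq0 (eq_zero_of_dvd_of_natDegree_lt h (by omega)))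
  exact this hx

omit [IsScalarTower k E[X] F] in
theorem dvd_of_pairing_mem_regularAt {D₁ D₂ : Derivation k F F} {d₁ d₂ : Derivation k E[X] E[X]}
    (h₁ : ∀ p, D₁ (algebraMap E[X] F p) = algebraMap E[X] F (d₁ p))
    (h₂ : ∀ p, D₂ (algebraMap E[X] F p) = algebraMap E[X] F (d₂ p))
    {π g : E[X]} (hπ : Prime π) (hg : g ≠ 0)
    (h : pairing D₁ D₂ (polySymb k F π g) ∈ regularAt F π hπ) :
    π ∣ d₁ π * d₂ g - d₂ π * d₁ g := by
  obtain ⟨a, b, hb, hab⟩ := h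
  have hp := pairing_polySymb (k := k) h₁ h₂ hπ.ne_zero hg
  have : (d₁ π * d₂ g - d₂ π * d₁ g) * b = π * (g * a) := by
    apply IsFractionRing.injective E[X] F
    rw [map_mul, ← hp, mul_right_comm, hab, ← map_mul]
    ring_nf
  exact (hπ.dvd_or_dvd ⟨_, this⟩).resolve_right hb

theorem exists_finsupp_of_mem_sup_iSup {A ι : Type*} [AddCommGroup A] {L : AddSubgroup A}
    {N : ι → AddSubgroup A} {x : A} (hx : x ∈ L ⊔ ⨆ i, N i) :
    ∃ f : ι →₀ A, (∀ i, f i ∈ N i) ∧ x - f.sum (fun _ a => a) ∈ L := by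
  classical
  obtain ⟨l, hl, y, hy, rfl⟩ := AddSubgroup.mem_sup.1 hx
  suffices ∃ f : ι →₀ A, (∀ i, f i ∈ N i) ∧ f.sum (fun _ a => a) = y by
    obtain ⟨f, hf, rfl⟩ := this
    exact ⟨f, hf, by simpa using hl⟩
  refine AddSubgroup.iSup_induction N
    (C := fun y => ∃ f : ι →₀ A, (∀ i, f i ∈ N i) ∧ f.sum (fun _ a => a) = y) hy ?_ ?_ ?_
  · intro i x hx
    refine ⟨Finsupp.single i x, fun j => ?_, by simp⟩
    rw [Finsupp.single_apply]
    split_ifs with h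
    · exact h ▸ hx
    · exact zero_mem _
  · exact ⟨0, fun i => zero_mem _, by simp⟩
  · rintro _ _ ⟨f, hf, rfl⟩ ⟨g, hg, rfl⟩
    exact ⟨f + g, fun i => add_mem (hf i) (hg i),
      Finsupp.sum_add_index' (fun _ => rfl) fun _ _ _ => rfl⟩

variable [CharZero E] [IsAlgClosed k]

theorem mem_degreeFiltration_of_succ (hE : DerivationsDetectConstants k E) {n : ℕ}
    {x : K2ModConst k F} (hx : x ∈ degreeFiltration k E F (n + 1))
    (h : ∀ D₁ D₂ : Derivation k F F, pairing D₁ D₂ x = 0) : x ∈ degreeFiltration k E F n := by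
  classical
  obtain ⟨f, hf, hl⟩ := exists_finsupp_of_mem_sup_iSup (degreeFiltration_succ_le n hx)
  suffices ∀ i ∈ f.support, f i ∈ degreeFiltration k E F n by
    have := add_mem hl (sum_mem this)
    rwa [Finsupp.sum, sub_add_cancel] at this
  intro i hi
  obtain ⟨π, hmonic, hirr, hn⟩ := i
  have hπ := hirr.prime
  obtain ⟨g, hg, hgn, hfg⟩ := hf ⟨π, hmonic, hirr, hn⟩
  obtain ⟨D₂, h₂⟩ := exists_derivation_isFractionRing (F := F)
    ((derivative' (R := E)).restrictScalars k)
  have hdvd (d : Derivation k E E) :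
      π ∣ d.mapPolynomial π * derivative g - derivative π * d.mapPolynomial g := by
    obtain ⟨D₁, h₁⟩ := exists_derivation_isFractionRing (F := F) d.mapPolynomial
    refine dvd_of_pairing_mem_regularAt h₁ h₂ hπ hg ?_
    have hreg {y : K2ModConst k F} (hy : y ∈ degreeFiltration k E F n) :
        pairing D₁ D₂ y ∈ regularAt F π hπ :=
      pairing_mem_regularAt_of_mem_degreeFiltration h₁ h₂ hπ (by omega) hy
    have hother : pairing D₁ D₂ (∑ j ∈ f.support.erase ⟨π, hmonic, hirr, hn⟩, f j) ∈
        regularAt F π hπ := by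
      rw [map_sum]
      refine sum_mem fun j hj => ?_
      obtain ⟨g', hg', hgn', hfg'⟩ := hf j
      have hne : j.1 ≠ π := fun e => Finset.ne_of_mem_erase hj (Subtype.ext e)
      have hπj : ¬ π ∣ j.1 := fun hd => hne <| (eq_of_monic_of_associated hmonic j.2.1
        (hirr.associated_of_dvd j.2.2.1 hd)).symm
      have := add_mem (hreg hfg') (pairing_polySymb_mem_regularAt (k := k) h₁ h₂ hπ hπj
        (q := g') (fun hd => hg' (eq_zero_of_dvd_of_natDegree_lt hd (by omega))))
      rwa [← map_add, sub_add_cancel] at this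
    have hsum := Finset.add_sum_erase _ (fun j => f j) hi
    have h3 := neg_mem (add_mem (add_mem (hreg hl) (hreg hfg)) hother)
    rw [← map_add, ← map_add, ← map_neg] at h3
    have h4 := h D₁ D₂
    rw [Finsupp.sum, ← hsum] at h3
    have h5 : polySymb k F π g = x + -(x - (f ⟨π, hmonic, hirr, hn⟩ +
        ∑ j ∈ f.support.erase ⟨π, hmonic, hirr, hn⟩, f j) +
        (f ⟨π, hmonic, hirr, hn⟩ - polySymb k F π g) +
        ∑ j ∈ f.support.erase ⟨π, hmonic, hirr, hn⟩, f j) := by abel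
    rw [h5, map_add, h4, zero_add]
    exact h3
  obtain ⟨c, rfl⟩ := exists_eq_C_of_forall_dvd hE hirr (by omega) hdvd
  rwa [polySymb_C_algebraMap, sub_zero] at hfg

theorem mem_degreeFiltration_zero (hE : DerivationsDetectConstants k E)
    {x : K2ModConst k F} (h : ∀ D₁ D₂ : Derivation k F F, pairing D₁ D₂ x = 0) :
    x ∈ degreeFiltration k E F 0 := by
  obtain ⟨n, hn⟩ := exists_mem_degreeFiltration (E := E) x
  induction n with
  | zero => exact hn
  | succ n ih => exact ih (mem_degreeFiltration_of_succ hE hn h)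

/-- If the pairings with derivations detect classes in `K₂(E)/Const`, then they do so for a
rational function field in one variable over `E`. -/
theorem PairingsDetectSymbols.of_isFractionRing_polynomial (hE : DerivationsDetectConstants k E)
    (hE' : PairingsDetectSymbols k E) : PairingsDetectSymbols k F := by
  intro x hx
  let φ : E →ₐ[k] F := (IsScalarTower.toAlgHom k E[X] F).comp
    ((Polynomial.CAlgHom (R := E) (A := E)).restrictScalars k)
  have hφ (a : E) : φ a = algebraMap E[X] F (C a) := rfl
  have hle : degreeFiltration k E F 0 ≤ (K2ModConst.map φ).range := by
    refine (AddSubgroup.closure_le _).2 ?_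
    rintro _ ⟨p, q, hp, hq, rfl⟩
    refine ⟨symb k (p.coeff 0) (q.coeff 0), ?_⟩
    rw [map_symb, hφ, hφ, ← eq_C_of_natDegree_le_zero hp, ← eq_C_of_natDegree_le_zero hq]
    rfl
  obtain ⟨y, rfl⟩ := hle (mem_degreeFiltration_zero hE hx)
  rw [hE' y, map_zero]
  intro d₁ d₂
  obtain ⟨D₁, h₁⟩ := exists_derivation_isFractionRing (F := F) d₁.mapPolynomial
  obtain ⟨D₂, h₂⟩ := exists_derivation_isFractionRing (F := F) d₂.mapPolynomial
  have h := pairing_map φ (d₁ := d₁) (d₂ := d₂) (D₁ := D₁) (D₂ := D₂)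
    (fun a => by rw [hφ, hφ, h₁, Derivation.mapPolynomial_C])
    (fun a => by rw [hφ, hφ, h₂, Derivation.mapPolynomial_C]) y
  rw [hx] at h
  exact (map_eq_zero_iff φ φ.injective).1 h.symm

end Residues

section RationalFunctionField

open Polynomial

attribute [local instance] Polynomial.algebra

theorem isFractionRing_polynomial_of_isFractionRing {A K F : Type*} [CommRing A] [IsDomain A]
    [Field K] [Field F] [Algebra A K] [IsFractionRing A K] [Algebra A[X] F] [Algebra K[X] F]
    [IsScalarTower A[X] K[X] F] [IsFractionRing K[X] F] : IsFractionRing A[X] F := by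
  have hinj : Function.Injective (algebraMap A[X] F) := by
    rw [IsScalarTower.algebraMap_eq A[X] K[X] F]
    exact (IsFractionRing.injective K[X] F).comp
      (Polynomial.map_injective _ (IsFractionRing.injective A K))
  have : FaithfulSMul A[X] F := (faithfulSMul_iff_algebraMap_injective _ _).2 hinj
  have hnum (p : K[X]) : ∃ b : A, b ≠ 0 ∧ ∃ r : A[X],
      algebraMap A[X] F r = algebraMap A[X] F (C b) * algebraMap K[X] F p := by
    obtain ⟨b, hb, h⟩ := IsLocalization.integerNormalization_spec (nonZeroDivisors A) p
    refine ⟨b, nonZeroDivisors.ne_zero hb,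
      IsLocalization.integerNormalization (nonZeroDivisors A) p, ?_⟩
    rw [IsScalarTower.algebraMap_apply A[X] K[X] F, IsScalarTower.algebraMap_apply A[X] K[X] F,
      ← map_mul]
    congr 1
    simp only [Polynomial.algebraMap_def, coe_mapRingHom, map_C]
    rw [h, ← smul_eq_C_mul, algebraMap_smul]
  refine IsFractionRing.of_field A[X] F fun z => ?_
  obtain ⟨p, q, hq, rfl⟩ := IsFractionRing.div_surjective K[X] z
  obtain ⟨b, hb, r, hr⟩ := hnum p
  obtain ⟨c, hc, s, hs⟩ := hnum q
  refine ⟨C c * r, C b * s, ?_⟩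
  have hb' := (map_ne_zero_iff _ hinj).2 (C_ne_zero.2 hb)
  have hc' := (map_ne_zero_iff _ hinj).2 (C_ne_zero.2 hc)
  have hq' := (map_ne_zero_iff _ (IsFractionRing.injective K[X] F)).2 (nonZeroDivisors.ne_zero hq)
  rw [map_mul, map_mul, hr, hs]
  field_simp

theorem detect_fractionRing_mvPolynomial (k : Type) [Field k] [IsAlgClosed k] [CharZero k] (n : ℕ) :
    DerivationsDetectConstants k (FractionRing (MvPolynomial (Fin n) k)) ∧
      PairingsDetectSymbols k (FractionRing (MvPolynomial (Fin n) k)) := by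
  induction n with
  | zero =>
    let e : k ≃ₐ[k] FractionRing (MvPolynomial (Fin 0) k) :=
      IsFractionRing.algEquivOfAlgEquiv (MvPolynomial.isEmptyAlgEquiv k (Fin 0)).symm
    exact ⟨(derivationsDetectConstants_self k).of_algEquiv e,
      (pairingsDetectSymbols_self k).of_algEquiv e⟩
  | succ n ih =>
    let K := FractionRing (MvPolynomial (Fin n) k)
    have : IsFractionRing (MvPolynomial (Fin n) k)[X] (FractionRing K[X]) :=
      isFractionRing_polynomial_of_isFractionRing (K := K)
    let e : FractionRing K[X] ≃ₐ[k] FractionRing (MvPolynomial (Fin (n + 1)) k) :=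
      IsFractionRing.algEquivOfAlgEquiv (MvPolynomial.finSuccEquiv k n).symm
    have : CharZero K :=
      charZero_of_injective_algebraMap (algebraMap k _).injective
    exact ⟨(ih.1.of_isFractionRing_polynomial).of_algEquiv e,
      (ih.2.of_isFractionRing_polynomial ih.1).of_algEquiv e⟩

end RationalFunctionField

/-- Let `k` be an algebraically closed field of characteristic 0 and
`F = k(x₁,…,xₙ)`. The assignment `{f,g} ↦ dlog f ∧ dlog g` determines a well-defined group
homomorphism `K₂ᴹ(F) → Ω²_{F/k}` which vanishes on all symbols `{f,c}` with `c ∈ k*`, hence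
descends to `K₂(F)/Const`; and the induced homomorphism `K₂(F)/Const → Ω²_{F/k}` is injective.
(This is expressed by the existence of an injective group homomorphism on `K₂(F)/Const`
sending the class of each symbol `{f,g}` to `dlog f ∧ dlog g`.) -/
theorem dlog_descends_and_injective
    (k : Type) [Field k] [IsAlgClosed k] [CharZero k] (n : ℕ) :
    ∃ Φ : K2ModConst k (FractionRing (MvPolynomial (Fin n) k)) →+
        ExteriorAlgebra (FractionRing (MvPolynomial (Fin n) k))
          (Ω[(FractionRing (MvPolynomial (Fin n) k))⁄k]),
      (∀ f g : (FractionRing (MvPolynomial (Fin n) k))ˣ,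
        Φ (QuotientAddGroup.mk (MilnorK2.symbol f g)) =
          dlogWedge k (f : FractionRing (MvPolynomial (Fin n) k))
            (g : FractionRing (MvPolynomial (Fin n) k))) ∧
      Function.Injective Φ := by
  refine ⟨K2ModConst.dlogHom k _, fun f g => ?_, ?_⟩
  · rw [← K2ModConst.symb_units, K2ModConst.dlogHom_symb]
  · refine (injective_iff_map_eq_zero _).2 fun x hx => ?_
    exact (detect_fractionRing_mvPolynomial k n).2 x
      (K2ModConst.pairing_eq_zero_of_dlogHom_eq_zero hx)
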